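/- For every integer k ≥ 3 there is no integer v for which a vgr(v, k, 3, C(k,2) − 1)-graph exists; that is, no k-regular graph of girth 3 has the property that every vertex lies on exactly (k choose 2) − 1 triangles. -/

import Mathlib

open SimpleGraph

/-- The number of closed walks based at `u` of length `g` that are cycles.
Since each (unoriented, basepoint-free) cycle of length `g ≥ 3` through `u`
corresponds to exactly two such closed walks (one for each orientation), this
equals twice the number of cycles of length `g` containing `u`. -/
noncomputable def vertexCycleCount {V : Type*} (G : SimpleGraph V) (g : ℕ) (u : V) : ℕ :=
  Nat.card {p : G.Walk u u // p.IsCycle ∧ p.length = g}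

/-- `IsVGR G v k g lam` says that `G` is a vertex-girth-regular
`vgr(v,k,g,lam)`-graph: a finite simple `k`-regular graph of girth `g` on `v`
vertices in which every vertex lies on exactly `lam` cycles of length `g`
(encoded as: `2 * lam` closed cycle-walks based at each vertex). -/
def IsVGR {V : Type*} (G : SimpleGraph V) (v k g lam : ℕ) : Prop :=
  Finite V ∧ Nat.card V = v ∧ (∀ u : V, Nat.card (G.neighborSet u) = k) ∧
    G.girth = (g : ℕ∞) ∧ ∀ u : V, vertexCycleCount G g u = 2 * lam

/-- Closed cycle-walks of length `3` at `u` correspond to ordered pairs of adjacent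
neighbors of `u`. -/
theorem vertexCycleCount_three {V : Type*} (G : SimpleGraph V) (u : V) :
    vertexCycleCount G 3 u =
      Nat.card {q : V × V // G.Adj u q.1 ∧ G.Adj q.1 q.2 ∧ G.Adj q.2 u} := by
  symm
  refine Nat.card_eq_of_bijective
    (fun q => ⟨.cons q.2.1 (.cons q.2.2.1 (.cons q.2.2.2 .nil)), ?_, rfl⟩) ⟨?_, ?_⟩
  · obtain ⟨⟨a, b⟩, h₁, h₂, h₃⟩ := q
    simp only at h₁ h₂ h₃
    have := h₁.ne
    have := h₂.ne
    have := h₃.ne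
    simp only [Walk.cons_isCycle_iff, Walk.cons_isPath_iff, Walk.isPath_iff_nil,
      Walk.support_cons, Walk.support_nil, Walk.edges_cons, Walk.edges_nil,
      List.mem_cons, List.not_mem_nil, Sym2.eq_iff, or_false]
    grind
  · rintro ⟨⟨a, b⟩, h⟩ ⟨⟨c, d⟩, h'⟩ e
    have e' := congrArg (fun p => p.1.support) e
    simp at e'
    simp [e']
  · rintro ⟨p, hp, hl⟩
    match p, hl with
    | .cons (v := a) h₁ (.cons (v := b) h₂ (.cons h₃ .nil)), _ =>
      exact ⟨⟨⟨a, b⟩, h₁, h₂, h₃⟩, rfl⟩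

/-- A vertex of degree `k` on `k.choose 2 - 1` triangles has exactly one pair of distinct
nonadjacent neighbors. -/
theorem exists_unique_nonadj_neighbors {V : Type*} [Finite V] (G : SimpleGraph V) {k : ℕ}
    (hk : 2 ≤ k) (u : V) (hd : Nat.card (G.neighborSet u) = k)
    (hc : vertexCycleCount G 3 u = 2 * (k.choose 2 - 1)) :
    ∃ x y, x ≠ y ∧ G.Adj u x ∧ G.Adj u y ∧ ¬ G.Adj x y ∧
      ∀ a b, G.Adj u a → G.Adj u b → a ≠ b → ¬ G.Adj a b →
        (a = x ∧ b = y) ∨ (a = y ∧ b = x) := by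
  classical
  have := Fintype.ofFinite V
  rw [Nat.card_eq_fintype_card, G.card_neighborSet_eq_degree] at hd
  rw [vertexCycleCount_three, Nat.card_eq_fintype_card, Fintype.card_subtype] at hc
  set A := G.neighborFinset u with hA
  set P := ({q : V × V | G.Adj u q.1 ∧ G.Adj q.1 q.2 ∧ G.Adj q.2 u} : Finset (V × V)) with hP
  have hPA : P ⊆ A.offDiag := by
    intro q hq
    simp only [hP, Finset.mem_filter, Finset.mem_univ, true_and] at hq
    simp [hA, hq.1, hq.2.2.symm, hq.2.1.ne]
  have hcard : (A.offDiag \ P).card = 2 := by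
    have hA' : A.card = k := hd
    rw [Finset.card_sdiff_of_subset hPA, Finset.offDiag_card, hA', hc]
    have h1 : k * (k - 1) = k * k - k := by rw [Nat.mul_sub, mul_one]
    have h2 := Nat.choose_two_right k
    have h3 : 2 ∣ k * (k - 1) := (Nat.even_mul_pred_self k).two_dvd
    have h4 : 0 < k.choose 2 := Nat.choose_pos hk
    omega
  have hmem : ∀ a b, (a, b) ∈ A.offDiag \ P ↔
      G.Adj u a ∧ G.Adj u b ∧ a ≠ b ∧ ¬ G.Adj a b := by
    intro a b
    simp only [hA, hP, Finset.mem_sdiff, Finset.mem_offDiag, mem_neighborFinset,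
      Finset.mem_filter, Finset.mem_univ, true_and, G.adj_comm b u]
    tauto
  obtain ⟨⟨x, y⟩, hxy⟩ : (A.offDiag \ P).Nonempty := by
    rw [← Finset.card_pos]
    omega
  obtain ⟨hx, hy, hne, hn⟩ := (hmem x y).1 hxy
  have hyx : (y, x) ∈ A.offDiag \ P := (hmem y x).2 ⟨hy, hx, hne.symm, fun h => hn h.symm⟩
  have hpair : ({(x, y), (y, x)} : Finset (V × V)) = A.offDiag \ P := by
    apply Finset.eq_of_subset_of_card_le
    · simp [Finset.insert_subset_iff, hxy, hyx, -Finset.mem_sdiff]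
    · rw [hcard, Finset.card_pair (by simp [hne])]
  refine ⟨x, y, hne, hx, hy, hn, fun a b ha hb hab hadj => ?_⟩
  have := (hmem a b).2 ⟨ha, hb, hab, hadj⟩
  rw [← hpair] at this
  simpa using this

/-- for every `k ≥ 3` there is no `vgr(v, k, 3, C(k,2) - 1)`-graph:
no `k`-regular graph of girth `3` in which every vertex lies on exactly
`(k choose 2) - 1` triangles. -/
theorem no_vgr_choose_sub_one (k : ℕ) (hk : 3 ≤ k) :
    ¬ ∃ (v : ℕ) (V : Type) (G : SimpleGraph V), IsVGR G v k 3 (k.choose 2 - 1) := by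
  classical
  rintro ⟨v, V, G, hfin, -, hreg, hgirth, hcount⟩
  have := Fintype.ofFinite V
  have hdeg : ∀ u, (G.neighborFinset u).card = k := fun u => by
    rw [← hreg u, Nat.card_eq_fintype_card, G.card_neighborSet_eq_degree,
      card_neighborFinset_eq_degree]
  have hpair := fun u => exists_unique_nonadj_neighbors G (by omega) u (hreg u) (hcount u)
  obtain ⟨u⟩ : Nonempty V := by
    by_contra hV
    rw [not_nonempty_iff] at hV
    have : G.girth = 0 := girth_eq_zero.2 fun v => hV.elim v
    rw [this] at hgirth
    norm_num at hgirth
  obtain ⟨x, y, hxy, hx, hy, hnxy, huniq⟩ := hpair u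
  obtain ⟨w, hw, hwxy⟩ : ∃ w ∈ G.neighborFinset u, w ∉ ({x, y} : Finset V) := by
    apply Finset.exists_mem_notMem_of_card_lt_card
    rw [hdeg, Finset.card_pair hxy]
    omega
  rw [mem_neighborFinset] at hw
  simp only [Finset.mem_insert, Finset.mem_singleton, not_or] at hwxy
  obtain ⟨hwx, hwy⟩ := hwxy
  have hwN : insert u ((G.neighborFinset u).erase w) = G.neighborFinset w := by
    apply Finset.eq_of_subset_of_card_le
    · intro a ha
      simp only [Finset.mem_insert, Finset.mem_erase, mem_neighborFinset] at ha ⊢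
      obtain rfl | ⟨haw, ha⟩ := ha
      · exact hw.symm
      · by_contra hn
        have := huniq w a hw ha haw.symm hn
        tauto
    · rw [Finset.card_insert_of_notMem (by simp), Finset.card_erase_of_mem (by simpa), hdeg, hdeg]
      omega
  obtain ⟨z, hz, hz'⟩ : ∃ z ∈ G.neighborFinset x,
      z ∉ insert u (((G.neighborFinset u).erase x).erase y) := by
    apply Finset.exists_mem_notMem_of_card_lt_card
    rw [Finset.card_insert_of_notMem (by simp),
      Finset.card_erase_of_mem (by simpa using ⟨hxy.symm, hy⟩),
      Finset.card_erase_of_mem (by simpa), hdeg, hdeg]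
    omega
  simp only [Finset.mem_insert, Finset.mem_erase, mem_neighborFinset, not_or] at hz hz'
  obtain ⟨hzu, hz'⟩ := hz'
  have hzx : z ≠ x := hz.ne'
  have hzy : z ≠ y := by rintro rfl; exact hnxy hz
  have hnuz : ¬ G.Adj u z := fun h => hz' ⟨hzy, hzx, h⟩
  have hnwz : ¬ G.Adj w z := by
    rw [← mem_neighborFinset, ← hwN]
    simp [hzu, hnuz]
  have hxw : G.Adj x w := by
    by_contra hn
    have := huniq x w hx hw (Ne.symm hwx) hn
    tauto
  have hzw : z ≠ w := by rintro rfl; exact hnuz hw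
  obtain ⟨p, q, -, -, -, -, huniq'⟩ := hpair x
  have h₁ := huniq' z u hz hx.symm hzu fun h => hnuz h.symm
  have h₂ := huniq' z w hz hxw hzw fun h => hnwz h.symm
  have := hw.ne
  grind
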